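/- For two agents, any number p of items, Borda utilities, and uniform independent profiles, the strictly alternating policy π* = 1212… of length p maximizes the expected utilitarian social welfare: for every policy π ∈ {1,2}^p, s̄w(π) ≤ s̄w(π*). -/

import Mathlib

open Finset

namespace SeqAlloc

/-- Given an agent's ranking `r` (a bijection sending each item to its position,
position `0` being the most preferred), pick the most preferred item of a
nonempty set `S` of remaining items. -/
def pickItem {p : ℕ} (r : Equiv.Perm (Fin p)) (S : Finset (Fin p)) (h : S.Nonempty) : Fin p :=
  r.symm ((S.image r).min' (h.image r))

/-- Sequential allocation: the agents in the list take turns; each takes her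
most preferred remaining item.  Returns the list of (agent, item) pairs. -/
def allocList {n p : ℕ} (R : Fin n → Equiv.Perm (Fin p)) :
    List (Fin n) → Finset (Fin p) → List (Fin n × Fin p)
  | [], _ => []
  | a :: rest, S =>
    if h : S.Nonempty then
      (a, pickItem (R a) S h) :: allocList R rest (S.erase (pickItem (R a) S h))
    else []

/-- The utility that agent `i` obtains when the items `Fin p` are allocated
sequentially according to the policy `π` under profile `R`, where an item
ranked in (1-indexed) position `k` by an agent is worth `g k` to her. -/
noncomputable def utilAgent {n p : ℕ} (g : ℕ → ℝ) (R : Fin n → Equiv.Perm (Fin p))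
    (π : List (Fin n)) (i : Fin n) : ℝ :=
  ((allocList R π Finset.univ).map
    (fun x => if x.1 = i then g (((R i) x.2).val + 1) else 0)).sum

/-- The expected utility of agent `i` under policy `π` for `p` items and scoring
function `g`, the profiles being drawn uniformly and independently. -/
noncomputable def expectedUtil (n p : ℕ) (g : ℕ → ℝ) (π : List (Fin n)) (i : Fin n) : ℝ :=
  (∑ R : Fin n → Equiv.Perm (Fin p), utilAgent g R π i) / ((p.factorial : ℝ) ^ n)

/-- Expected Borda utility: an item ranked (1-indexed) in position `k` is worth
`p - k + 1`. -/
noncomputable def expectedBordaUtil (n p : ℕ) (π : List (Fin n)) (i : Fin n) : ℝ :=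
  expectedUtil n p (fun k => (p : ℝ) - k + 1) π i

/-- The strictly alternating policy `1212…` of length `p` for two agents. -/
def altPolicy (p : ℕ) : List (Fin 2) :=
  (List.range p).map (fun k => if k % 2 = 0 then 0 else 1)

end SeqAlloc

namespace SeqAlloc

/-! ### The deterministic recursion -/

/-- Expected utility of agent `i`, by recursion on the policy. -/
noncomputable def uu (i : Fin 2) : List (Fin 2) → ℝ
  | [] => 0
  | a :: t => if a = i then ((t.length : ℝ) + 1) + uu i t
      else ((t.length : ℝ) + 2) / ((t.length : ℝ) + 1) * uu i t

lemma uu_self (i : Fin 2) (t : List (Fin 2)) :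
    uu i (i :: t) = ((t.length : ℝ) + 1) + uu i t := by simp [uu]

lemma uu_other {i j : Fin 2} (h : i ≠ j) (t : List (Fin 2)) :
    uu j (i :: t) = ((t.length : ℝ) + 2) / ((t.length : ℝ) + 1) * uu j t := by simp [uu, h]

lemma uu_nonneg (i : Fin 2) (t : List (Fin 2)) : 0 ≤ uu i t := by
  induction t with
  | nil => simp [uu]
  | cons a t ih =>
    unfold uu
    split_ifs <;> positivity

lemma fin2_cases {i j : Fin 2} (h : i ≠ j) (a : Fin 2) : a = i ∨ a = j := by omega

lemma exists_swap {i j : Fin 2} (h : i ≠ j) (t : List (Fin 2)) :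
    ∃ t' : List (Fin 2), t'.length = t.length ∧ uu i t' = uu j t ∧ uu j t' = uu i t := by
  induction t with
  | nil => exact ⟨[], rfl, by simp [uu], by simp [uu]⟩
  | cons a t ih =>
    obtain ⟨t', h0, h1, h2⟩ := ih
    rcases fin2_cases h a with rfl | rfl
    · refine ⟨j :: t', by simp [h0], ?_, ?_⟩
      · rw [uu_other h.symm, uu_other h, h0, h1]
      · rw [uu_self, uu_self, h0, h2]
    · refine ⟨i :: t', by simp [h0], ?_, ?_⟩
      · rw [uu_self, uu_self, h0, h1]
      · rw [uu_other h.symm, uu_other h, h0, h2]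

/-- alternating policy -/
def alt (i j : Fin 2) : ℕ → List (Fin 2)
  | 0 => []
  | n + 1 => i :: alt j i n

lemma alt_length (i j : Fin 2) (n : ℕ) : (alt i j n).length = n := by
  induction n generalizing i j with
  | zero => rfl
  | succ n ih => simp [alt, ih]

lemma uu_alt_swap {i j : Fin 2} (h : i ≠ j) (n : ℕ) :
    uu i (alt i j n) = uu j (alt j i n) ∧ uu j (alt i j n) = uu i (alt j i n) := by
  induction n generalizing i j with
  | zero => simp [alt, uu]
  | succ n ih =>
    have := ih h
    simp only [alt]
    rw [uu_self, uu_self, uu_other h, uu_other h.symm, alt_length, alt_length, this.1, this.2]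
    exact ⟨rfl, rfl⟩

lemma uu_alt_le {i j : Fin 2} (h : i ≠ j) (n : ℕ) :
    uu j (alt i j n) ≤ uu i (alt i j n) := by
  induction n using Nat.twoStepInduction with
  | zero => simp [alt, uu]
  | one => simp [alt, uu, h]
  | more n ih _ =>
    simp only [alt]
    rw [uu_self, uu_other h, uu_self, uu_other h.symm]
    simp only [List.length_cons, alt_length]
    push_cast
    have h1 := uu_nonneg j (alt i j n)
    set a := uu j (alt i j n)
    set b := uu i (alt i j n)
    have e1 : ((n : ℝ) + 1 + 2) / ((n : ℝ) + 1 + 1) ≤ ((n : ℝ) + 2) / ((n : ℝ) + 1) := by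
      rw [div_le_div_iff₀ (by positivity) (by positivity)]; nlinarith
    have e2 : ((n : ℝ) + 1 + 2) / ((n : ℝ) + 1 + 1) * ((n : ℝ) + 1) ≤ (n : ℝ) + 1 + 1 := by
      rw [div_mul_eq_mul_div, div_le_iff₀ (by positivity)]; nlinarith
    have e3 : ((n : ℝ) + 1 + 2) / ((n : ℝ) + 1 + 1) * a ≤ ((n : ℝ) + 2) / ((n : ℝ) + 1) * b :=
      mul_le_mul e1 ih h1 (by positivity)
    linarith

/-- The greedy claim for `n+1` items. -/
def Greedy (n : ℕ) : Prop :=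
  ∀ (i j : Fin 2), i ≠ j → ∀ (α β : ℝ), 0 ≤ β → β ≤ α → ∀ π : List (Fin 2), π.length = n + 1 →
    ∃ ρ : List (Fin 2), ρ.length = n ∧
      α * uu i π + β * uu j π ≤ α * uu i (i :: ρ) + β * uu j (i :: ρ)

lemma window (m : ℕ) (hG : ∀ n < m, Greedy n) (i j : Fin 2) (hij : i ≠ j) (α β : ℝ)
    (hβ : 0 ≤ β) (h : β ≤ α) (hw : ((m : ℝ) + 1) * α ≤ (m + 2) * β)
    (π : List (Fin 2)) (hπ : π.length = m) :
    α * uu i π + β * uu j π ≤ α * uu i (alt i j m) + β * uu j (alt i j m) := by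
  induction m generalizing i j α β π with
  | zero =>
    obtain rfl := List.length_eq_zero_iff.mp hπ
    simp [alt]
  | succ m ih =>
    obtain ⟨ρ, hρ, hle⟩ := hG m (by omega) i j hij α β hβ h π hπ
    refine hle.trans ?_
    simp only [alt]
    rw [uu_self, uu_self, uu_other hij, uu_other hij, hρ, alt_length]
    push_cast at hw
    have key := ih (fun n hn => hG n (by omega)) j i hij.symm
      (β * (((m : ℝ) + 2) / ((m : ℝ) + 1))) α (hβ.trans h) ?_ ?_ ρ hρ
    · nlinarith [key]
    · rw [← mul_div_assoc, le_div_iff₀ (by positivity)]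
      have hm : (0 : ℝ) ≤ m := by positivity
      have : ((m : ℝ) + 2) * (α * (m + 1)) ≤ (m + 2) * (β * (m + 2)) := by nlinarith
      exact le_of_mul_le_mul_left this (by positivity)
    · have : ((m : ℝ) + 1) * (β * (((m : ℝ) + 2) / ((m : ℝ) + 1))) = β * (m + 2) := by
        field_simp
      rw [this]
      have hm : (0 : ℝ) ≤ m := by positivity
      nlinarith

lemma greedy (n : ℕ) : Greedy n := by
  induction n using Nat.strong_induction_on with
  | _ n IH =>
  intro i j hij α β hβ h π hπ
  obtain ⟨a, π', rfl⟩ : ∃ a π', π = a :: π' := by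
    cases π with
    | nil => simp at hπ
    | cons a t => exact ⟨a, t, rfl⟩
  have hπ' : π'.length = n := by simpa using hπ
  rcases fin2_cases hij a with rfl | rfl
  · exact ⟨π', hπ', le_rfl⟩
  cases n with
  | zero =>
    obtain rfl := List.length_eq_zero_iff.mp hπ'
    refine ⟨[], rfl, ?_⟩
    rw [uu_self, uu_self, uu_other hij, uu_other hij.symm]
    simp [uu, h]
  | succ m =>
    have hm : (0 : ℝ) ≤ m := by positivity
    have hα : 0 ≤ α := hβ.trans h
    set c : ℝ := ((m : ℝ) + 3) / ((m : ℝ) + 2) with hc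
    set d : ℝ := ((m : ℝ) + 2) / ((m : ℝ) + 1) with hd
    have hc1 : 1 ≤ c := by rw [hc, le_div_iff₀ (by positivity)]; linarith
    have hcd : c ≤ d := by
      rw [hc, hd, div_le_div_iff₀ (by positivity) (by positivity)]; nlinarith
    have hcm : c * (m + 2) = m + 3 := by rw [hc]; field_simp
    have hdm : d * (m + 1) = m + 2 := by rw [hd]; field_simp
    have ha0 : ∀ t : List (Fin 2), t.length = m + 1 → uu i (a :: t) = c * uu i t := by
      intro t ht
      rw [uu_other hij.symm, ht, hc]; push_cast; ring_nf
    have ha1 : ∀ t : List (Fin 2), t.length = m + 1 → uu a (i :: t) = c * uu a t := by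
      intro t ht
      rw [uu_other hij, ht, hc]; push_cast; ring_nf
    have ha2 : ∀ t : List (Fin 2), t.length = m + 1 → uu a (a :: t) = m + 2 + uu a t := by
      intro t ht
      rw [uu_self, ht]; push_cast; ring
    have ha3 : ∀ t : List (Fin 2), t.length = m + 1 → uu i (i :: t) = m + 2 + uu i t := by
      intro t ht
      rw [uu_self, ht]; push_cast; ring
    have hb0 : ∀ t : List (Fin 2), t.length = m → uu i (a :: t) = d * uu i t := by
      intro t ht
      rw [uu_other hij.symm, ht]
    have hb1 : ∀ t : List (Fin 2), t.length = m → uu a (i :: t) = d * uu a t := by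
      intro t ht
      rw [uu_other hij, ht]
    have hb2 : ∀ (b : Fin 2) (t : List (Fin 2)), t.length = m →
        uu b (b :: t) = m + 1 + uu b t := by
      intro b t ht
      rw [uu_self, ht]
    have hβc : β ≤ α * c := h.trans (le_mul_of_one_le_right hα hc1)
    obtain ⟨ρ, hρ, hle⟩ := IH m (by omega) i a hij (α * c) β hβ hβc π' hπ'
    rw [hb2 i ρ hρ, hb1 ρ hρ] at hle
    have hL : α * uu i (a :: π') + β * uu a (a :: π')
        ≤ β * (m + 2) + α * c * (m + 1) + (α * c * uu i ρ + β * d * uu a ρ) := by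
      rw [ha0 π' hπ', ha2 π' hπ']
      linarith
    rcases le_or_gt (β * d) (α * c) with hcase | hcase
    · obtain ⟨σ, hσ, hge, hσv⟩ : ∃ σ : List (Fin 2), σ.length = m ∧ uu a σ ≤ uu i σ ∧
          α * c * uu i ρ + β * d * uu a ρ ≤ α * c * uu i σ + β * d * uu a σ := by
        rcases le_total (uu a ρ) (uu i ρ) with h1 | h1
        · exact ⟨ρ, hρ, h1, le_rfl⟩
        · obtain ⟨σ, s0, s1, s2⟩ := exists_swap hij ρ
          refine ⟨σ, s0.trans hρ, by rw [s1, s2]; exact h1, ?_⟩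
          rw [s1, s2]
          nlinarith [mul_nonneg (sub_nonneg.2 hcase) (sub_nonneg.2 h1)]
      refine ⟨a :: σ, by simp [hσ], ?_⟩
      rw [ha3 _ (by simp [hσ]), ha1 _ (by simp [hσ]), hb0 σ hσ, hb2 a σ hσ]
      have hc2 : c * (m + 1) ≤ m + 2 := by nlinarith
      have k1 : 0 ≤ (α - β) * ((m + 2) - c * (m + 1)) :=
        mul_nonneg (sub_nonneg.2 h) (sub_nonneg.2 hc2)
      have k2 : β * uu a σ ≤ α * uu i σ := mul_le_mul h hge (uu_nonneg _ _) hα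
      have k3 : 0 ≤ (d - c) * (α * uu i σ - β * uu a σ) :=
        mul_nonneg (sub_nonneg.2 hcd) (sub_nonneg.2 k2)
      nlinarith
    · have hW := window m (fun n hn => IH n (by omega)) a i hij.symm (β * d) (α * c)
        (by positivity) hcase.le ?_ ρ hρ
      · refine ⟨alt a i (m + 1), alt_length _ _ _, ?_⟩
        have e1 := uu_alt_swap hij (m + 2)
        have e2 := uu_alt_le hij (m + 2)
        change _ ≤ α * uu i (alt i a (m + 2)) + β * uu a (alt i a (m + 2))
        have hV : α * uu i (a :: π') + β * uu a (a :: π')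
            ≤ α * uu i (alt a i (m + 2)) + β * uu a (alt a i (m + 2)) := by
          have l := alt_length a i m
          have l' := alt_length i a (m + 1)
          have r1 : uu i (alt a i (m + 2)) = c * (m + 1 + uu i (alt a i m)) := by
            rw [alt, ha0 _ l', alt, hb2 i _ l]
          have r2 : uu a (alt a i (m + 2)) = m + 2 + d * uu a (alt a i m) := by
            rw [alt, ha2 _ l', alt, hb1 _ l]
          rw [r1, r2]
          linarith
        rw [← e1.1, ← e1.2] at hV
        nlinarith [mul_nonneg (sub_nonneg.2 h) (sub_nonneg.2 e2)]
      · have q1 : ((m : ℝ) + 1) * (β * d) = β * (m + 2) := by rw [← hdm]; ring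
        have q2 : ((m : ℝ) + 2) * (α * c) = α * (m + 3) := by rw [← hcm]; ring
        rw [q1, q2]
        nlinarith

lemma alt_optimal (π : List (Fin 2)) :
    uu 0 π + uu 1 π ≤ uu 0 (alt 0 1 π.length) + uu 1 (alt 0 1 π.length) := by
  have := window π.length (fun n _ => greedy n) 0 1 (by decide) 1 1 zero_le_one le_rfl
    (by linarith) π rfl
  simpa using this

lemma altPolicy_eq (p : ℕ) : altPolicy p = alt 0 1 p := by
  have key : ∀ (p : ℕ), ((List.range p).map (fun k => if k % 2 = 0 then (0 : Fin 2) else 1)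
      = alt 0 1 p) ∧ ((List.range p).map (fun k => if k % 2 = 0 then (1 : Fin 2) else 0)
      = alt 1 0 p) := by
    intro p
    induction p with
    | zero => simp [alt]
    | succ p ih =>
      constructor
      · rw [List.range_succ_eq_map, alt, ← ih.2]
        simp only [List.map_cons, List.map_map]
        congr 1
        apply List.map_congr_left
        intro k _
        simp only [Function.comp]
        split_ifs <;> first | rfl | omega
      · rw [List.range_succ_eq_map, alt, ← ih.1]
        simp only [List.map_cons, List.map_map]
        congr 1
        apply List.map_congr_left
        intro k _
        simp only [Function.comp]
        split_ifs <;> first | rfl | omega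
  exact (key p).1

/-! ### The probabilistic reduction -/

lemma pickItem_mem {p : ℕ} (r : Equiv.Perm (Fin p)) (S : Finset (Fin p)) (h : S.Nonempty) :
    pickItem r S h ∈ S := by
  have := (S.image r).min'_mem (h.image r)
  obtain ⟨x, hx, e⟩ := Finset.mem_image.1 this
  unfold pickItem
  rw [← e]; simpa using hx

lemma pickItem_eq {p : ℕ} (r : Equiv.Perm (Fin p)) (S : Finset (Fin p)) (h : S.Nonempty)
    (x : Fin p) (hx : x ∈ S) (hmin : ∀ y ∈ S, r x ≤ r y) : pickItem r S h = x := by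
  unfold pickItem
  rw [Equiv.symm_apply_eq]
  apply le_antisymm
  · exact Finset.min'_le _ _ (Finset.mem_image_of_mem _ hx)
  · apply Finset.le_min'
    intro y hy
    obtain ⟨z, hz, rfl⟩ := Finset.mem_image.1 hy
    exact hmin z hz

lemma pickItem_le {p : ℕ} (r : Equiv.Perm (Fin p)) (S : Finset (Fin p)) (h : S.Nonempty)
    (y : Fin p) (hy : y ∈ S) : r (pickItem r S h) ≤ r y := by
  unfold pickItem
  simpa using Finset.min'_le _ _ (Finset.mem_image_of_mem r hy)

/-- Insert item `x` at position `q` into the ranking `r`. -/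
def build {k : ℕ} (x q : Fin (k + 1)) (r : Equiv.Perm (Fin k)) : Equiv.Perm (Fin (k + 1)) :=
  (finSuccEquiv' x).trans ((Equiv.optionCongr r).trans (finSuccEquiv' q).symm)

@[simp] lemma build_same {k : ℕ} (x q : Fin (k + 1)) (r : Equiv.Perm (Fin k)) :
    build x q r x = q := by simp [build]

@[simp] lemma build_succAbove {k : ℕ} (x q : Fin (k + 1)) (r : Equiv.Perm (Fin k)) (z : Fin k) :
    build x q r (x.succAbove z) = q.succAbove (r z) := by simp [build]

lemma allocList_build {n k : ℕ} (x : Fin (k + 1)) (q : Fin n → Fin (k + 1))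
    (R : Fin n → Equiv.Perm (Fin k)) (π : List (Fin n)) (S : Finset (Fin k)) :
    allocList (fun i => build x (q i) (R i)) π (S.map x.succAboveEmb)
      = (allocList R π S).map (fun y => (y.1, x.succAbove y.2)) := by
  induction π generalizing S with
  | nil => simp [allocList]
  | cons a t ih =>
    by_cases h : S.Nonempty
    · have h' : (S.map x.succAboveEmb).Nonempty := h.map
      have e : pickItem (build x (q a) (R a)) (S.map x.succAboveEmb) h'
          = x.succAbove (pickItem (R a) S h) := by
        apply pickItem_eq
        · exact Finset.mem_map_of_mem x.succAboveEmb (pickItem_mem _ _ _)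
        · intro y hy
          obtain ⟨z, hz, rfl⟩ := Finset.mem_map.1 hy
          simp only [Fin.coe_succAboveEmb, build_succAbove]
          exact (Fin.strictMono_succAbove _).monotone (pickItem_le _ _ _ _ hz)
      have e2 : (S.map x.succAboveEmb).erase (x.succAbove (pickItem (R a) S h))
          = (S.erase (pickItem (R a) S h)).map x.succAboveEmb := by
        rw [Finset.map_erase]; rfl
      simp only [allocList, dif_pos h, dif_pos h', List.map_cons, e, e2, ih]
    · have h' : ¬ (S.map x.succAboveEmb).Nonempty := by simpa using h
      simp only [allocList, dif_neg h, dif_neg h', List.map_nil]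

/-- Build a profile on `k+1` items in which agent `a` has top item `x`. -/
def buildR {k : ℕ} (a : Fin 2) (y : (Fin (k + 1) × Fin (k + 1)) × (Fin 2 → Equiv.Perm (Fin k))) :
    Fin 2 → Equiv.Perm (Fin (k + 1)) :=
  fun i => build y.1.1 (if i = a then 0 else y.1.2) (y.2 i)

lemma buildR_bij {k : ℕ} (a : Fin 2) : Function.Bijective (buildR (k := k) a) := by
  rw [Fintype.bijective_iff_injective_and_card]
  constructor
  · rintro ⟨⟨x, q⟩, R⟩ ⟨⟨x', q'⟩, R'⟩ h
    have hx : x = x' := by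
      have h1 := congrFun h a
      simp only [buildR, if_true] at h1
      apply (build x 0 (R a)).injective
      rw [build_same, h1, build_same]
    subst hx
    obtain ⟨b, hb⟩ : ∃ b : Fin 2, b ≠ a := ⟨1 - a, by omega⟩
    have hq : q = q' := by
      have h1 := congrFun h b
      simp only [buildR, if_neg hb] at h1
      rw [← build_same x q (R b), h1, build_same]
    subst hq
    have : R = R' := by
      funext i
      ext1 z
      have h1 := congrArg (fun e => e (x.succAbove z)) (congrFun h i)
      simp only [buildR, build_succAbove] at h1
      exact Fin.succAbove_right_injective h1
    rw [this]
  · simp [Fintype.card_perm, Nat.factorial_succ]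
    ring

lemma utilAgent_buildR {k : ℕ} (g : ℕ → ℝ) (a : Fin 2) (x q : Fin (k + 1))
    (R : Fin 2 → Equiv.Perm (Fin k)) (t : List (Fin 2)) (i : Fin 2) :
    utilAgent g (buildR a ((x, q), R)) (a :: t) i = (if a = i then g 1 else 0) +
      ((allocList R t Finset.univ).map (fun y => if y.1 = i then
        g ((((if i = a then (0 : Fin (k + 1)) else q).succAbove (R i y.2)) : ℕ) + 1)
          else 0)).sum := by
  have h : (Finset.univ : Finset (Fin (k + 1))).Nonempty := Finset.univ_nonempty
  have e : pickItem (buildR a ((x, q), R) a) Finset.univ h = x := by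
    apply pickItem_eq
    · simp
    · intro y _
      simp [buildR]
  have e2 : (Finset.univ : Finset (Fin (k + 1))).erase x
      = (Finset.univ : Finset (Fin k)).map x.succAboveEmb := by
    ext y
    simp only [Finset.mem_erase, Finset.mem_univ, and_true, Finset.mem_map, true_and,
      Fin.coe_succAboveEmb]
    exact ⟨fun h => Fin.exists_succAbove_eq h, by rintro ⟨z, rfl⟩; exact Fin.succAbove_ne _ _⟩
  have e3 := allocList_build x (fun i => if i = a then 0 else q) R t Finset.univ
  unfold utilAgent
  rw [allocList, dif_pos h, List.map_cons, List.sum_cons, e, e2]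
  have e4 : allocList (buildR a ((x, q), R)) t (Finset.univ.map x.succAboveEmb) = _ := e3
  rw [e4, List.map_map]
  congr 1
  · by_cases hi : a = i
    · subst hi; simp [buildR]
    · simp [hi]
  · congr 1
    apply List.map_congr_left
    intro y _
    simp [buildR]

lemma sum_succAbove {k : ℕ} (v : Fin k) :
    ∑ q : Fin (k + 1), (((k + 1 : ℕ) : ℝ) - (((q.succAbove v : Fin (k + 1)) : ℕ) + 1 : ℕ) + 1)
      = ((k : ℝ) + 2) * ((k : ℝ) - ((v : ℕ) + 1 : ℕ) + 1) := by
  have h1 : ∀ q : Fin (k + 1), ((((q.succAbove v : Fin (k + 1)) : ℕ) : ℝ))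
      = (v : ℕ) + (if q ≤ v.castSucc then 1 else 0) := by
    intro q
    split_ifs with h
    · rw [Fin.succAbove_of_le_castSucc _ _ h]; simp
    · rw [Fin.succAbove_of_castSucc_lt _ _ (not_le.1 h)]; simp
  have h2 : ∑ q : Fin (k + 1), (if q ≤ v.castSucc then (1 : ℝ) else 0) = (v : ℕ) + 1 := by
    rw [Finset.sum_boole]
    have : (Finset.univ.filter (fun q : Fin (k + 1) => q ≤ v.castSucc)) = Finset.Iic v.castSucc := by
      ext; simp
    rw [this, Fin.card_Iic]
    simp
  push_cast
  simp only [h1, Finset.sum_add_distrib, Finset.sum_sub_distrib, h2]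
  simp
  ring

lemma list_sum_comm {ι κ : Type*} (s : Finset ι) (l : List κ) (f : ι → κ → ℝ) :
    ∑ q ∈ s, (l.map (f q)).sum = (l.map (fun y => ∑ q ∈ s, f q y)).sum := by
  induction l with
  | nil => simp
  | cons a t ih => simp [Finset.sum_add_distrib, ih]

lemma expected_eq (π : List (Fin 2)) (i : Fin 2) :
    expectedBordaUtil 2 π.length π i = uu i π := by
  induction π with
  | nil => simp [expectedBordaUtil, expectedUtil, utilAgent, allocList, uu]
  | cons a t ih =>
    set k := t.length with hk
    unfold expectedBordaUtil expectedUtil at ih ⊢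
    rw [List.length_cons, ← hk]
    have hf : (k.factorial : ℝ) ≠ 0 := by positivity
    have hk1 : (k : ℝ) + 1 ≠ 0 := by positivity
    rw [div_eq_iff (by positivity)] at ih ⊢
    rw [← (buildR_bij (k := k) a).sum_comp, Fintype.sum_prod_type, Fintype.sum_prod_type]
    simp only [utilAgent_buildR]
    rw [Nat.factorial_succ]
    by_cases hi : a = i
    · subst hi
      have : ∀ R : Fin 2 → Equiv.Perm (Fin k),
          ((allocList R t Finset.univ).map (fun y => if y.1 = a then
          (((k + 1 : ℕ) : ℝ) - ((((if a = a then (0 : Fin (k + 1)) else 0).succAbove (R a y.2) :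
            Fin (k + 1)) : ℕ) + 1 : ℕ) + 1) else 0)).sum
          = utilAgent (fun k' => (k : ℝ) - k' + 1) R t a := by
        intro R
        unfold utilAgent
        congr 1
        apply List.map_congr_left
        intro y _
        split_ifs <;> simp
      simp only [if_true] at this ⊢
      simp only [this, Finset.sum_add_distrib, ih, uu_self]
      simp [Fintype.card_perm]
      ring
    · have hi' : ¬ i = a := fun h => hi h.symm
      have : ∀ R : Fin 2 → Equiv.Perm (Fin k),
          ∑ q : Fin (k + 1), ((allocList R t Finset.univ).map (fun y => if y.1 = i then
          (((k + 1 : ℕ) : ℝ) - (((q.succAbove (R i y.2) :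
            Fin (k + 1)) : ℕ) + 1 : ℕ) + 1) else 0)).sum
          = ((k : ℝ) + 2) * utilAgent (fun k' => (k : ℝ) - k' + 1) R t i := by
        intro R
        rw [list_sum_comm]
        unfold utilAgent
        rw [← List.sum_map_mul_left]
        congr 1
        apply List.map_congr_left
        intro y _
        split_ifs
        · exact sum_succAbove _
        · simp
      simp only [if_neg hi, if_neg hi', zero_add]
      simp only [Finset.sum_comm (s := (Finset.univ : Finset (Fin (k + 1))))
        (t := (Finset.univ : Finset (Fin 2 → Equiv.Perm (Fin k))))]
      simp only [this, ← Finset.mul_sum, uu_other hi, ← hk]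
      simp
      field_simp
      rw [← Finset.mul_sum, ih]
      ring

end SeqAlloc

/-- For two agents, any number `p` of items, Borda utilities and
uniform independent profiles, the strictly alternating policy `π* = 1212…` of length
`p` maximizes the expected utilitarian social welfare:
`s̄w(π) ≤ s̄w(π*)` for every policy `π ∈ {1,2}^p`. -/
theorem stmt7 (p : ℕ) (π : List (Fin 2)) (hlen : π.length = p) :
    SeqAlloc.expectedBordaUtil 2 p π 0 + SeqAlloc.expectedBordaUtil 2 p π 1
      ≤ SeqAlloc.expectedBordaUtil 2 p (SeqAlloc.altPolicy p) 0
        + SeqAlloc.expectedBordaUtil 2 p (SeqAlloc.altPolicy p) 1 := by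
  subst hlen
  have h := SeqAlloc.expected_eq (SeqAlloc.alt 0 1 π.length)
  rw [SeqAlloc.alt_length] at h
  rw [SeqAlloc.altPolicy_eq, SeqAlloc.expected_eq, SeqAlloc.expected_eq, h, h]
  exact SeqAlloc.alt_optimal π
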